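/- Let K(x,t) = ∫_ℝ e^{-it(βξ³+γ/ξ) + ixξ} χ_{[N,4N]}(|ξ|) dξ with β < 0, γ > 0, and N ≥ a a dyadic number (a as above). Then for every γ₀ ≥ 7, ‖K‖_{L_x^{γ₀/2} L_t^∞} ≤ C N^{(γ₀-2)/γ₀}, where the constant C depends only on β, γ, γ₀. -/

import Mathlib

open MeasureTheory

theorem norm_cexp_I_mul (r : ℝ) : ‖Complex.exp (Complex.I * (r : ℂ))‖ = 1 := by
  rw [mul_comm]; exact Complex.norm_exp_ofReal_mul_I r

/-- Integration by parts for an oscillatory integral without stationary points. -/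
theorem norm_oscillatory_le_of_le_abs_deriv {f f1 f2 : ℝ → ℝ} {a b l : ℝ} (hab : a ≤ b) (hl : 0 < l)
    (hf : ∀ x ∈ Set.Icc a b, HasDerivAt f (f1 x) x)
    (hf1 : ∀ x ∈ Set.Icc a b, HasDerivAt f1 (f2 x) x)
    (hf2 : ContinuousOn f2 (Set.Icc a b))
    (hlf : ∀ x ∈ Set.Icc a b, l ≤ |f1 x|) :
    ‖∫ x in a..b, Complex.exp (Complex.I * (f x : ℂ))‖
      ≤ 2 / l + ∫ x in a..b, |f2 x| / (f1 x) ^ 2 := by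
  have hne : ∀ x ∈ Set.Icc a b, f1 x ≠ 0 := fun x hx h => by
    have := hlf x hx
    rw [h, abs_zero] at this
    linarith
  have hcf : ContinuousOn f (Set.Icc a b) := fun x hx => (hf x hx).continuousAt.continuousWithinAt
  have hcf1 : ContinuousOn f1 (Set.Icc a b) :=
    fun x hx => (hf1 x hx).continuousAt.continuousWithinAt
  have hcE : ContinuousOn (fun x => Complex.exp (Complex.I * (f x : ℂ))) (Set.Icc a b) := by
    fun_prop
  have hcq : ContinuousOn (fun x => f2 x / (f1 x) ^ 2) (Set.Icc a b) :=
    hf2.div (hcf1.pow 2) fun x hx => pow_ne_zero 2 (hne x hx)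
  have hcG : ContinuousOn (fun x => Complex.exp (Complex.I * (f x : ℂ)) *
      (Complex.I * ((f2 x / (f1 x) ^ 2 : ℝ) : ℂ))) (Set.Icc a b) := by
    fun_prop
  have hder : ∀ x ∈ Set.uIcc a b, HasDerivAt
      (fun x => Complex.exp (Complex.I * (f x : ℂ)) * (-Complex.I * (((f1 x)⁻¹ : ℝ) : ℂ)))
      (Complex.exp (Complex.I * (f x : ℂ)) + Complex.exp (Complex.I * (f x : ℂ)) *
        (Complex.I * ((f2 x / (f1 x) ^ 2 : ℝ) : ℂ))) x := by
    intro x hx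
    rw [Set.uIcc_of_le hab] at hx
    have h1 := (((hf x hx).ofReal_comp).const_mul Complex.I).cexp
    have h2 := (((hf1 x hx).inv (hne x hx)).ofReal_comp).const_mul (-Complex.I)
    refine (h1.mul h2).congr_deriv ?_
    have h0 : (f1 x : ℂ) ≠ 0 := by exact_mod_cast hne x hx
    simp only [Pi.inv_apply]
    push_cast
    field_simp
    linear_combination (-(f1 x : ℂ) ^ 2) * Complex.I_sq
  have hiE : IntervalIntegrable (fun x => Complex.exp (Complex.I * (f x : ℂ))) volume a b :=
    ContinuousOn.intervalIntegrable (by rwa [Set.uIcc_of_le hab])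
  have hiG : IntervalIntegrable (fun x => Complex.exp (Complex.I * (f x : ℂ)) *
      (Complex.I * ((f2 x / (f1 x) ^ 2 : ℝ) : ℂ))) volume a b :=
    ContinuousOn.intervalIntegrable (by rwa [Set.uIcc_of_le hab])
  have hI := intervalIntegral.integral_eq_sub_of_hasDerivAt hder (hiE.add hiG)
  rw [intervalIntegral.integral_add hiE hiG] at hI
  rw [eq_sub_of_add_eq hI]
  have hb : ∀ x ∈ Set.Icc a b,
      ‖Complex.exp (Complex.I * (f x : ℂ)) * (-Complex.I * (((f1 x)⁻¹ : ℝ) : ℂ))‖ ≤ 1 / l := by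
    intro x hx
    rw [norm_mul, norm_cexp_I_mul, norm_mul, norm_neg, Complex.norm_I, Complex.norm_real,
      one_mul, one_mul, Real.norm_eq_abs, abs_inv, ← one_div]
    exact one_div_le_one_div_of_le hl (hlf x hx)
  have hG : ‖∫ x in a..b, Complex.exp (Complex.I * (f x : ℂ)) *
      (Complex.I * ((f2 x / (f1 x) ^ 2 : ℝ) : ℂ))‖ ≤ ∫ x in a..b, |f2 x| / (f1 x) ^ 2 := by
    refine (intervalIntegral.norm_integral_le_integral_norm hab).trans_eq ?_
    congr 1
    ext x
    rw [norm_mul, norm_cexp_I_mul, norm_mul, Complex.norm_I, Complex.norm_real, one_mul, one_mul,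
      Real.norm_eq_abs, abs_div, abs_of_nonneg (sq_nonneg (f1 x))]
  have hba := hb a (Set.left_mem_Icc.2 hab)
  have hbb := hb b (Set.right_mem_Icc.2 hab)
  have h2 : 2 / l = 1 / l + 1 / l := by ring
  refine (norm_sub_le _ _).trans ?_
  have := norm_sub_le
    (Complex.exp (Complex.I * (f b : ℂ)) * (-Complex.I * (((f1 b)⁻¹ : ℝ) : ℂ)))
    (Complex.exp (Complex.I * (f a : ℂ)) * (-Complex.I * (((f1 a)⁻¹ : ℝ) : ℂ)))
  linarith

/-- First-order van der Corput estimate for a convex increasing phase. -/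
theorem norm_oscillatory_le_of_le_deriv {f f1 f2 : ℝ → ℝ} {a b l : ℝ} (hab : a ≤ b) (hl : 0 < l)
    (hf : ∀ x ∈ Set.Icc a b, HasDerivAt f (f1 x) x)
    (hf1 : ∀ x ∈ Set.Icc a b, HasDerivAt f1 (f2 x) x)
    (hf2 : ContinuousOn f2 (Set.Icc a b)) (h0 : ∀ x ∈ Set.Icc a b, 0 ≤ f2 x)
    (hlf : ∀ x ∈ Set.Icc a b, l ≤ f1 x) :
    ‖∫ x in a..b, Complex.exp (Complex.I * (f x : ℂ))‖ ≤ 3 / l := by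
  have hpos : ∀ x ∈ Set.Icc a b, 0 < f1 x := fun x hx => hl.trans_le (hlf x hx)
  have hcf1 : ContinuousOn f1 (Set.Icc a b) :=
    fun x hx => (hf1 x hx).continuousAt.continuousWithinAt
  refine (norm_oscillatory_le_of_le_abs_deriv hab hl hf hf1 hf2
    fun x hx => (hlf x hx).trans (le_abs_self _)).trans ?_
  have hI : ∫ x in a..b, |f2 x| / (f1 x) ^ 2 = -(f1 b)⁻¹ - -(f1 a)⁻¹ := by
    refine intervalIntegral.integral_eq_sub_of_hasDerivAt (f := fun x => -(f1 x)⁻¹) ?_ ?_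
    · intro x hx
      rw [Set.uIcc_of_le hab] at hx
      refine ((hf1 x hx).inv (hpos x hx).ne').neg.congr_deriv ?_
      rw [abs_of_nonneg (h0 x hx)]
      ring
    · refine ContinuousOn.intervalIntegrable ?_
      rw [Set.uIcc_of_le hab]
      exact hf2.abs.div (hcf1.pow 2) fun x hx => pow_ne_zero 2 (hpos x hx).ne'
  rw [hI]
  have h1 : (f1 a)⁻¹ ≤ l⁻¹ := inv_anti₀ hl (hlf a (Set.left_mem_Icc.2 hab))
  have h2 : 0 < (f1 b)⁻¹ := inv_pos.2 (hpos b (Set.right_mem_Icc.2 hab))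
  have h3 : 3 / l = 2 / l + l⁻¹ := by ring
  linarith

theorem norm_integral_cexp_I_mul_le (f : ℝ → ℝ) {a b : ℝ} (hab : a ≤ b) :
    ‖∫ x in a..b, Complex.exp (Complex.I * (f x : ℂ))‖ ≤ b - a := by
  have := intervalIntegral.norm_integral_le_of_norm_le_const (a := a) (b := b) (C := 1)
    (f := fun x => Complex.exp (Complex.I * (f x : ℂ))) fun x _ => (norm_cexp_I_mul (f x)).le
  rwa [one_mul, abs_of_nonneg (sub_nonneg.2 hab)] at this

/-- Second-order van der Corput estimate for a convex phase increasing on the interval. -/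
theorem norm_oscillatory_le_of_deriv_left_nonneg {f f1 f2 : ℝ → ℝ} {a b m : ℝ} (hab : a ≤ b)
    (hm : 0 < m)
    (hf : ∀ x ∈ Set.Icc a b, HasDerivAt f (f1 x) x)
    (hf1 : ∀ x ∈ Set.Icc a b, HasDerivAt f1 (f2 x) x)
    (hf2 : ContinuousOn f2 (Set.Icc a b)) (hmf : ∀ x ∈ Set.Icc a b, m ≤ f2 x)
    (ha : 0 ≤ f1 a) :
    ‖∫ x in a..b, Complex.exp (Complex.I * (f x : ℂ))‖ ≤ 4 / √m := by
  have hs : 0 < √m := Real.sqrt_pos.2 hm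
  have hss : √m * √m = m := Real.mul_self_sqrt hm.le
  have h4 : 4 / √m = 1 / √m + 3 / √m := by ring
  have hd0 : 0 < 1 / √m := by positivity
  rcases le_total b (a + 1 / √m) with h | h
  · have := norm_integral_cexp_I_mul_le f hab
    have : 0 < 3 / √m := by positivity
    linarith
  set d := a + 1 / √m with hd
  have had : a ≤ d := by linarith
  have hsub : Set.Icc d b ⊆ Set.Icc a b := Set.Icc_subset_Icc_left had
  have hcf : ContinuousOn f (Set.Icc a b) := fun x hx => (hf x hx).continuousAt.continuousWithinAt
  have hcE : ContinuousOn (fun x => Complex.exp (Complex.I * (f x : ℂ))) (Set.Icc a b) := by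
    fun_prop
  rw [← intervalIntegral.integral_add_adjacent_intervals (b := d)
    (ContinuousOn.intervalIntegrable
      (by rw [Set.uIcc_of_le had]; exact hcE.mono (Set.Icc_subset_Icc_right h)))
    (ContinuousOn.intervalIntegrable (by rw [Set.uIcc_of_le h]; exact hcE.mono hsub)), h4]
  refine (norm_add_le _ _).trans (add_le_add ?_ ?_)
  · simpa [hd] using norm_integral_cexp_I_mul_le f had
  · refine norm_oscillatory_le_of_le_deriv h hs (fun x hx => hf x (hsub hx))
      (fun x hx => hf1 x (hsub hx)) (hf2.mono hsub)
      (fun x hx => hm.le.trans (hmf x (hsub hx))) fun x hx => ?_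
    have key := (convex_Icc a b).mul_sub_le_image_sub_of_le_deriv (f := f1) (C := m)
      (fun y hy => (hf1 y hy).continuousAt.continuousWithinAt)
      (fun y hy => (hf1 y (interior_subset hy)).differentiableAt.differentiableWithinAt)
      (fun y hy => by
        rw [(hf1 y (interior_subset hy)).deriv]
        exact hmf y (interior_subset hy)) a (Set.left_mem_Icc.2 hab) x (hsub hx)
      (had.trans hx.1)
    have h5 : m * (1 / √m) ≤ m * (x - a) :=
      mul_le_mul_of_nonneg_left (by linarith [hx.1]) hm.le
    have h6 : m * (1 / √m) = √m := by
      rw [mul_one_div, div_eq_iff hs.ne', hss]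
    linarith

theorem norm_oscillatory_le_of_deriv_right_nonpos {f f1 f2 : ℝ → ℝ} {a b m : ℝ} (hab : a ≤ b)
    (hm : 0 < m)
    (hf : ∀ x ∈ Set.Icc a b, HasDerivAt f (f1 x) x)
    (hf1 : ∀ x ∈ Set.Icc a b, HasDerivAt f1 (f2 x) x)
    (hf2 : ContinuousOn f2 (Set.Icc a b)) (hmf : ∀ x ∈ Set.Icc a b, m ≤ f2 x)
    (hb : f1 b ≤ 0) :
    ‖∫ x in a..b, Complex.exp (Complex.I * (f x : ℂ))‖ ≤ 4 / √m := by
  have hmem : ∀ x ∈ Set.Icc (-b) (-a), -x ∈ Set.Icc a b := fun x hx =>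
    ⟨by linarith [hx.2], by linarith [hx.1]⟩
  have := norm_oscillatory_le_of_deriv_left_nonneg (f := fun x => f (-x))
    (f1 := fun x => -f1 (-x)) (f2 := fun x => f2 (-x)) (neg_le_neg hab) hm
    (fun x hx => ((hf (-x) (hmem x hx)).scomp x (hasDerivAt_neg x)).congr_deriv (by simp))
    (fun x hx => ((hf1 (-x) (hmem x hx)).scomp x (hasDerivAt_neg x)).neg.congr_deriv (by simp))
    (hf2.comp continuous_neg.continuousOn hmem) (fun x hx => hmf _ (hmem x hx)) (by simpa using hb)
  rwa [intervalIntegral.integral_comp_neg (fun x => Complex.exp (Complex.I * (f x : ℂ))),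
    neg_neg, neg_neg] at this

/-- Second-order van der Corput estimate for a convex phase. -/
theorem norm_oscillatory_le_of_le_deriv2 {f f1 f2 : ℝ → ℝ} {a b m : ℝ} (hab : a ≤ b)
    (hm : 0 < m)
    (hf : ∀ x ∈ Set.Icc a b, HasDerivAt f (f1 x) x)
    (hf1 : ∀ x ∈ Set.Icc a b, HasDerivAt f1 (f2 x) x)
    (hf2 : ContinuousOn f2 (Set.Icc a b)) (hmf : ∀ x ∈ Set.Icc a b, m ≤ f2 x) :
    ‖∫ x in a..b, Complex.exp (Complex.I * (f x : ℂ))‖ ≤ 8 / √m := by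
  have h8 : 8 / √m = 4 / √m + 4 / √m := by ring
  have h0 : 0 ≤ 4 / √m := by positivity
  rcases le_total 0 (f1 a) with ha | ha
  · linarith [norm_oscillatory_le_of_deriv_left_nonneg hab hm hf hf1 hf2 hmf ha]
  rcases le_total (f1 b) 0 with hb | hb
  · linarith [norm_oscillatory_le_of_deriv_right_nonpos hab hm hf hf1 hf2 hmf hb]
  obtain ⟨c, hc, hc0⟩ := intermediate_value_Icc hab
    (fun x hx => (hf1 x hx).continuousAt.continuousWithinAt) (Set.mem_Icc.2 ⟨ha, hb⟩)
  have hl : Set.Icc a c ⊆ Set.Icc a b := Set.Icc_subset_Icc_right hc.2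
  have hr : Set.Icc c b ⊆ Set.Icc a b := Set.Icc_subset_Icc_left hc.1
  have hcf : ContinuousOn f (Set.Icc a b) := fun x hx => (hf x hx).continuousAt.continuousWithinAt
  have hcE : ContinuousOn (fun x => Complex.exp (Complex.I * (f x : ℂ))) (Set.Icc a b) := by
    fun_prop
  rw [← intervalIntegral.integral_add_adjacent_intervals (b := c)
    (ContinuousOn.intervalIntegrable (by rw [Set.uIcc_of_le hc.1]; exact hcE.mono hl))
    (ContinuousOn.intervalIntegrable (by rw [Set.uIcc_of_le hc.2]; exact hcE.mono hr)), h8]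
  refine (norm_add_le _ _).trans (add_le_add ?_ ?_)
  · exact norm_oscillatory_le_of_deriv_right_nonpos hc.1 hm (fun x hx => hf x (hl hx))
      (fun x hx => hf1 x (hl hx)) (hf2.mono hl) (fun x hx => hmf x (hl hx)) hc0.le
  · exact norm_oscillatory_le_of_deriv_left_nonneg hc.2 hm (fun x hx => hf x (hr hx))
      (fun x hx => hf1 x (hr hx)) (hf2.mono hr) (fun x hx => hmf x (hr hx)) hc0.ge

theorem norm_integral_cexp_I_mul_neg (f : ℝ → ℝ) (a b : ℝ) :
    ‖∫ x in a..b, Complex.exp (Complex.I * ((-f x : ℝ) : ℂ))‖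
      = ‖∫ x in a..b, Complex.exp (Complex.I * (f x : ℂ))‖ := by
  have : ∀ x, Complex.exp (Complex.I * ((-f x : ℝ) : ℂ))
      = (starRingEnd ℂ) (Complex.exp (Complex.I * (f x : ℂ))) := fun x => by
    rw [← Complex.exp_conj]
    simp
  simp_rw [this]
  rw [intervalIntegral.intervalIntegral_eq_integral_uIoc,
    intervalIntegral.intervalIntegral_eq_integral_uIoc, integral_conj, norm_smul, norm_smul,
    RCLike.norm_conj]

theorem hasDerivAt_phase (β γ x t : ℝ) {y : ℝ} (hy : y ≠ 0) :
    HasDerivAt (fun y => x * y - t * (β * y ^ 3 + γ / y))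
      (x - t * (3 * β * y ^ 2 - γ / y ^ 2)) y := by
  have h1 := ((hasDerivAt_id y).const_mul x).sub
    ((((hasDerivAt_pow 3 y).const_mul β).add ((hasDerivAt_inv hy).const_mul γ)).const_mul t)
  refine h1.congr_deriv ?_
  simp only [Nat.cast_ofNat]
  ring

theorem hasDerivAt_deriv_phase (β γ x t : ℝ) {y : ℝ} (hy : y ≠ 0) :
    HasDerivAt (fun y => x - t * (3 * β * y ^ 2 - γ / y ^ 2))
      (-t * (6 * β * y + 2 * γ / y ^ 3)) y := by
  have h1 := (((((hasDerivAt_pow 2 y).const_mul (3 * β)).sub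
    (((hasDerivAt_pow 2 y).inv (pow_ne_zero 2 hy)).const_mul γ)).const_mul t).const_sub x)
  refine h1.congr_deriv ?_
  simp only [Nat.cast_ofNat]
  field_simp
  ring

/-- Pointwise bound, uniform in `t`, for the part of the kernel with positive frequencies. -/
theorem norm_half_kernel_le {b γ N : ℝ} (hb : 0 < b) (hγ : 0 < γ) (hN : 1 ≤ N)
    (hNb : 4 * γ ≤ 3 * b * N ^ 4) (x t : ℝ) :
    ‖∫ y in N..(4 * N),
        Complex.exp (Complex.I * ((x * y - t * (-b * y ^ 3 + γ / y) : ℝ) : ℂ))‖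
      ≤ (20 + 8 * √((48 * b + 2 * γ) / b)) * (N / √(1 + N * |x|)) := by
  have hN0 : 0 < N := by linarith
  have hab : N ≤ 4 * N := by linarith
  set B := 48 * b + 2 * γ with hB
  have hB0 : 0 < B := by positivity
  set s := 1 + N * |x| with hs
  have hs1 : 1 ≤ s := le_add_of_nonneg_right (by positivity)
  have hrs1 : 1 ≤ √s := Real.one_le_sqrt.2 hs1
  have hrs0 : 0 < √s := by linarith
  have hrss : √s ≤ s := Real.sqrt_le_self_iff.2 (Or.inr hs1)
  have hD0 : 0 ≤ √(B / b) := Real.sqrt_nonneg _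
  rw [← mul_div_assoc, le_div_iff₀ hrs0]
  rcases le_or_gt (N * |x|) 1 with hx | hx
  · have h1 := norm_integral_cexp_I_mul_le (fun y => x * y - t * (-b * y ^ 3 + γ / y)) hab
    have h2 : √s ≤ 2 := by linarith
    calc _ ≤ (4 * N - N) * 2 := mul_le_mul h1 h2 hrs0.le (by linarith)
      _ ≤ 20 * N := by linarith
      _ ≤ _ := by gcongr; linarith
  have hx0 : 0 < |x| := by
    by_contra h
    have : N * |x| ≤ 0 := mul_nonpos_of_nonneg_of_nonpos hN0.le (not_lt.1 h)
    linarith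
  have hs2 : s ≤ 2 * (N * |x|) := by linarith
  have hpos : ∀ y ∈ Set.Icc N (4 * N), 0 < y := fun y hy => hN0.trans_le hy.1
  have hder : ∀ y ∈ Set.Icc N (4 * N), HasDerivAt (fun y => x * y - t * (-b * y ^ 3 + γ / y))
      (x - t * (3 * -b * y ^ 2 - γ / y ^ 2)) y :=
    fun y hy => hasDerivAt_phase _ _ _ _ (hpos y hy).ne'
  have hder2 : ∀ y ∈ Set.Icc N (4 * N), HasDerivAt
      (fun y => x - t * (3 * -b * y ^ 2 - γ / y ^ 2))
      (-t * (6 * -b * y + 2 * γ / y ^ 3)) y :=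
    fun y hy => hasDerivAt_deriv_phase _ _ _ _ (hpos y hy).ne'
  have hcont : ContinuousOn (fun y : ℝ => -t * (6 * -b * y + 2 * γ / y ^ 3))
      (Set.Icc N (4 * N)) := by
    have : ∀ y ∈ Set.Icc N (4 * N), y ^ 3 ≠ 0 := fun y hy => pow_ne_zero 3 (hpos y hy).ne'
    fun_prop (disch := assumption)
  have hq : ∀ y ∈ Set.Icc N (4 * N), ∀ k : ℕ, γ / y ^ k ≤ γ := fun y hy k =>
    div_le_self hγ.le (one_le_pow₀ (hN.trans hy.1))
  rcases le_or_gt (|t| * (2 * B * N ^ 2)) |x| with ht | ht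
  · have hf1 : ∀ y ∈ Set.Icc N (4 * N), |x| / 2 ≤ |x - t * (3 * -b * y ^ 2 - γ / y ^ 2)| := by
      intro y hy
      have h1 : |3 * -b * y ^ 2 - γ / y ^ 2| ≤ B * N ^ 2 := by
        have h2 : y ^ 2 ≤ (4 * N) ^ 2 := by gcongr; exacts [(hpos y hy).le, hy.2]
        have h3 := hq y hy 2
        have h4 : 0 ≤ γ / y ^ 2 := by positivity
        have h5 : γ ≤ γ * N ^ 2 := le_mul_of_one_le_right hγ.le (one_le_pow₀ hN)
        have h6 : b * y ^ 2 ≤ b * (4 * N) ^ 2 := by gcongr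
        have h7 : 0 ≤ b * y ^ 2 := by positivity
        rw [abs_le, hB]
        constructor <;> nlinarith
      have h2 : |t * (3 * -b * y ^ 2 - γ / y ^ 2)| ≤ |t| * (B * N ^ 2) := by
        rw [abs_mul]; gcongr
      have h3 := abs_sub_abs_le_abs_sub x (t * (3 * -b * y ^ 2 - γ / y ^ 2))
      linarith
    have hf2 : ∀ y ∈ Set.Icc N (4 * N), |-t * (6 * -b * y + 2 * γ / y ^ 3)| ≤ |x| / (2 * N) := by
      intro y hy
      have h1 : |6 * -b * y + 2 * γ / y ^ 3| ≤ B * N := by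
        have h3 := hq y hy 3
        have h4 : 0 ≤ γ / y ^ 3 := by have := hpos y hy; positivity
        have h5 : γ ≤ γ * N := le_mul_of_one_le_right hγ.le hN
        have h6 : b * y ≤ b * (4 * N) := by gcongr; exact hy.2
        have h7 : 0 ≤ b * y := by have := hpos y hy; positivity
        rw [abs_le, hB, mul_div_assoc]
        constructor <;> nlinarith
      rw [abs_mul, abs_neg, le_div_iff₀ (by positivity)]
      calc |t| * |6 * -b * y + 2 * γ / y ^ 3| * (2 * N) ≤ |t| * (B * N) * (2 * N) := by gcongr
        _ = |t| * (2 * B * N ^ 2) := by ring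
        _ ≤ |x| := ht
    have h1 := norm_oscillatory_le_of_le_abs_deriv hab (half_pos hx0) hder hder2 hcont hf1
    have h2 : ∫ y in N..(4 * N), |-t * (6 * -b * y + 2 * γ / y ^ 3)| /
        (x - t * (3 * -b * y ^ 2 - γ / y ^ 2)) ^ 2 ≤ 6 / |x| := by
      have h3 := intervalIntegral.norm_integral_le_of_norm_le_const (a := N) (b := 4 * N)
        (C := |x| / (2 * N) / (|x| / 2) ^ 2)
        (f := fun y => |-t * (6 * -b * y + 2 * γ / y ^ 3)| /
        (x - t * (3 * -b * y ^ 2 - γ / y ^ 2)) ^ 2) (by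
          intro y hy
          rw [Set.uIoc_of_le hab] at hy
          have hy' := Set.Ioc_subset_Icc_self hy
          rw [Real.norm_eq_abs, abs_div, abs_abs, abs_pow]
          have := hf1 y hy'
          gcongr
          exact hf2 y hy')
      refine ((le_abs_self _).trans h3).trans_eq ?_
      rw [abs_of_nonneg (sub_nonneg.2 hab)]
      field_simp
      norm_num
    have h3 : ‖∫ y in N..(4 * N),
        Complex.exp (Complex.I * ((x * y - t * (-b * y ^ 3 + γ / y) : ℝ) : ℂ))‖ ≤ 10 / |x| := by
      have : 2 / (|x| / 2) + 6 / |x| = 10 / |x| := by field_simp; norm_num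
      linarith
    calc _ ≤ 10 / |x| * (2 * (N * |x|)) := by gcongr; exact hrss.trans hs2
      _ = 20 * N := by field_simp; norm_num
      _ ≤ _ := by gcongr; linarith
  · set m := 2 * b * |x| / (B * N) with hm
    have hm0 : 0 < m := by positivity
    have hlow : ∀ y ∈ Set.Icc N (4 * N), m ≤ |t| * (6 * b * y - 2 * γ / y ^ 3) := by
      intro y hy
      have hy0 := hpos y hy
      have h1 : 2 * γ / y ^ 3 ≤ 2 * b * y := by
        rw [div_le_iff₀ (by positivity)]
        have : b * N ^ 4 ≤ b * y ^ 4 := by gcongr; exact hy.1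
        nlinarith
      have h2 : 4 * b * N ≤ 6 * b * y - 2 * γ / y ^ 3 := by
        have : b * N ≤ b * y := by gcongr; exact hy.1
        linarith
      calc m ≤ |t| * (4 * b * N) := by
            rw [hm, div_le_iff₀ (by positivity)]
            nlinarith
        _ ≤ _ := by gcongr
    have hE : ‖∫ y in N..(4 * N),
        Complex.exp (Complex.I * ((x * y - t * (-b * y ^ 3 + γ / y) : ℝ) : ℂ))‖ ≤ 8 / √m := by
      rcases le_total 0 t with h0 | h0
      · refine norm_oscillatory_le_of_le_deriv2 hab hm0 hder hder2 hcont fun y hy => ?_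
        refine (hlow y hy).trans_eq ?_
        rw [abs_of_nonneg h0]
        ring
      · rw [← norm_integral_cexp_I_mul_neg]
        refine norm_oscillatory_le_of_le_deriv2 hab hm0 (fun y hy => (hder y hy).neg)
          (fun y hy => (hder2 y hy).neg) hcont.neg fun y hy => ?_
        refine (hlow y hy).trans_eq ?_
        rw [abs_of_nonpos h0]
        ring
    have h3 : √s ≤ √(B / b) * (N * √m) := by
      have h4 : 2 * (N * |x|) = B / b * (N ^ 2 * m) := by
        rw [hm]; field_simp
      rw [h4] at hs2
      refine (Real.sqrt_le_sqrt hs2).trans_eq ?_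
      rw [Real.sqrt_mul (by positivity), Real.sqrt_mul (by positivity), Real.sqrt_sq hN0.le]
    have hm1 : 0 < √m := Real.sqrt_pos.2 hm0
    calc _ ≤ 8 / √m * (√(B / b) * (N * √m)) := by gcongr
      _ = 8 * √(B / b) * N := by field_simp
      _ ≤ _ := by gcongr; linarith

/-- Pointwise bound for the kernel, uniform in `t`. -/
theorem norm_kernel_le {b γ N : ℝ} (hb : 0 < b) (hγ : 0 < γ) (hN : 1 ≤ N)
    (hNb : 4 * γ ≤ 3 * b * N ^ 4) (x t : ℝ) :
    ‖∫ y in {y : ℝ | N ≤ |y| ∧ |y| ≤ 4 * N},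
        Complex.exp (Complex.I * ((x * y - t * (-b * y ^ 3 + γ / y) : ℝ) : ℂ))‖
      ≤ 2 * (20 + 8 * √((48 * b + 2 * γ) / b)) * (N / √(1 + N * |x|)) := by
  have hN0 : 0 < N := by linarith
  have hset : {y : ℝ | N ≤ |y| ∧ |y| ≤ 4 * N} =
      Set.Icc (-(4 * N)) (-N) ∪ Set.Icc N (4 * N) := by
    ext y
    simp only [Set.mem_ofPred_eq, Set.mem_union, Set.mem_Icc, abs_le, le_abs]
    constructor
    · rintro ⟨h | h, h1, h2⟩
      · exact Or.inr ⟨h, h2⟩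
      · exact Or.inl ⟨h1, by linarith⟩
    · rintro (⟨h1, h2⟩ | ⟨h1, h2⟩)
      · exact ⟨Or.inr (by linarith), h1, by linarith⟩
      · exact ⟨Or.inl h1, by linarith, h2⟩
  have hdis : Disjoint (Set.Icc (-(4 * N)) (-N)) (Set.Icc N (4 * N)) :=
    Set.disjoint_left.2 fun y h1 h2 => by linarith [h1.2, h2.1]
  have hint : ∀ u v : ℝ, (∀ y ∈ Set.Icc u v, y ≠ 0) → IntegrableOn (fun y : ℝ =>
      Complex.exp (Complex.I * ((x * y - t * (-b * y ^ 3 + γ / y) : ℝ) : ℂ))) (Set.Icc u v) := by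
    intro u v h
    refine ContinuousOn.integrableOn_Icc ?_
    fun_prop (disch := assumption)
  rw [hset, setIntegral_union hdis measurableSet_Icc
    (hint _ _ fun y hy => by linarith [hy.2] |> fun h : y < 0 => h.ne)
    (hint _ _ fun y hy => (hN0.trans_le hy.1).ne'),
    integral_Icc_eq_integral_Ioc, integral_Icc_eq_integral_Ioc,
    ← intervalIntegral.integral_of_le (by linarith), ← intervalIntegral.integral_of_le (by linarith),
    ← intervalIntegral.integral_comp_neg]
  refine (norm_add_le _ _).trans ?_
  have h1 := norm_half_kernel_le hb hγ hN hNb x t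
  have h2 := norm_half_kernel_le hb hγ hN hNb (-x) (-t)
  rw [abs_neg] at h2
  have h3 : ∀ y : ℝ, x * -y - t * (-b * (-y) ^ 3 + γ / -y)
      = -x * y - -t * (-b * y ^ 3 + γ / y) := fun y => by
    rw [div_neg]; ring
  simp_rw [h3]
  linarith

theorem le_two_zpow_floor {A : ℝ} (hA : 1 ≤ A) : A ≤ (2 : ℝ) ^ ⌊A⌋ := by
  obtain ⟨n, hn⟩ := Int.eq_ofNat_of_zero_le (Int.floor_nonneg.2 (zero_le_one.trans hA))
  have h1 := Int.lt_floor_add_one A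
  rw [hn] at h1 ⊢
  have h2 : ((n + 1 : ℕ) : ℝ) ≤ ((2 ^ n : ℕ) : ℝ) := by exact_mod_cast Nat.lt_two_pow_self
  push_cast at h1 h2
  simpa using h1.le.trans h2

theorem div_sqrt_rpow {N : ℝ} (hN : 0 < N) (p x : ℝ) :
    (N / √(1 + N * |x|)) ^ p = N ^ p * (1 + ‖N * x‖) ^ (-(p / 2)) := by
  have h0 : 0 < 1 + N * |x| := by positivity
  rw [Real.div_rpow hN.le (Real.sqrt_nonneg _), Real.sqrt_eq_rpow, ← Real.rpow_mul h0.le,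
    div_eq_mul_inv, ← Real.rpow_neg h0.le, norm_mul, Real.norm_of_nonneg hN.le, Real.norm_eq_abs]
  ring_nf

theorem integral_div_sqrt_rpow {N p : ℝ} (hN : 0 < N) :
    ∫ x : ℝ, (N / √(1 + N * |x|)) ^ p
      = N ^ (p - 1) * ∫ x : ℝ, (1 + ‖x‖) ^ (-(p / 2)) := by
  simp_rw [div_sqrt_rpow hN]
  rw [integral_const_mul, Measure.integral_comp_mul_left (fun x : ℝ => (1 + ‖x‖) ^ (-(p / 2))),
    smul_eq_mul, abs_of_pos (inv_pos.2 hN), Real.rpow_sub_one hN.ne']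
  ring

theorem integrable_div_sqrt_rpow {N p : ℝ} (hN : 0 < N) (hp : 2 < p) :
    Integrable fun x : ℝ => (N / √(1 + N * |x|)) ^ p := by
  simp_rw [div_sqrt_rpow hN]
  have h1 : Integrable fun x : ℝ => (1 + ‖x‖) ^ (-(p / 2)) :=
    integrable_one_add_norm (by rw [Module.finrank_self]; push_cast; linarith)
  exact (h1.comp_mul_left' hN.ne').const_mul _

/-- kernel estimate ‖K‖_{L_x^{γ₀/2} L_t^∞} ≤ C N^{(γ₀-2)/γ₀} for
K(x,t) = ∫ e^{-it(βξ³+γ/ξ)+ixξ} χ_{[N,4N]}(|ξ|) dξ and dyadic N ≥ a. -/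
theorem stmt9 (β γ γ₀ : ℝ) (hβ : β < 0) (hγ : 0 < γ) (hγ₀ : 7 ≤ γ₀) :
    ∃ C > (0:ℝ), ∀ N : ℝ, (∃ z : ℤ, N = 2^z) →
      (2:ℝ) ^ (⌊max 1 (max (|6*γ/(7*β)| ^ ((1:ℝ)/4)) (max (|γ/(3*β)| ^ ((1:ℝ)/2))
          (max |γ/β| (max (100*|β|) (100*|γ|)))))⌋) ≤ N →
      (∫ x : ℝ, (⨆ t : ℝ,
          ‖∫ ξ in {ξ : ℝ | N ≤ |ξ| ∧ |ξ| ≤ 4*N},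
              Complex.exp (Complex.I * ((x*ξ - t*(β*ξ^3 + γ/ξ) : ℝ) : ℂ))‖) ^ (γ₀/2))
          ^ (2/γ₀)
        ≤ C * N ^ ((γ₀-2)/γ₀) := by
  obtain ⟨b, rfl⟩ : ∃ b, β = -b := ⟨-β, (neg_neg β).symm⟩
  have hb : 0 < b := neg_lt_zero.1 hβ
  set D := 2 * (20 + 8 * √((48 * b + 2 * γ) / b)) with hD
  have hD0 : 0 < D := by positivity
  set J := ∫ x : ℝ, (1 + ‖x‖) ^ (-(γ₀ / 2 / 2)) with hJ
  have hJ0 : 0 ≤ J := integral_nonneg fun x => by positivity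
  refine ⟨D * J ^ (2 / γ₀) + 1, by positivity, fun N _ hN => ?_⟩
  set A := max 1 (max (|6*γ/(7*(-b))| ^ ((1:ℝ)/4)) (max (|γ/(3*(-b))| ^ ((1:ℝ)/2))
          (max |γ/(-b)| (max (100*|(-b)|) (100*|γ|))))) with hA
  have hA1 : 1 ≤ A := le_max_left _ _
  have hAN : A ≤ N := (le_two_zpow_floor hA1).trans hN
  have hN1 : 1 ≤ N := hA1.trans hAN
  have hN2 : 2 ≤ N := by
    have h1 : 1 ≤ ⌊A⌋ := Int.le_floor.2 (by exact_mod_cast hA1)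
    have h2 := zpow_le_zpow_right₀ (one_le_two (α := ℝ)) h1
    rw [zpow_one] at h2
    exact h2.trans hN
  have hN0 : 0 < N := by linarith
  have hNb : 4 * γ ≤ 3 * b * N ^ 4 := by
    have h1 : |γ / (3 * -b)| ^ ((1:ℝ)/2) ≤ N :=
      ((le_max_left _ _).trans ((le_max_right _ _).trans (le_max_right _ _))).trans hAN
    rw [← Real.sqrt_eq_rpow, Real.sqrt_le_left hN0.le, mul_neg, div_neg, abs_neg,
      abs_of_pos (by positivity), div_le_iff₀ (by positivity)] at h1
    have h2 : 2 ^ 2 ≤ N ^ 2 := by gcongr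
    nlinarith
  have hker := norm_kernel_le hb hγ hN1 hNb
  have hp : 0 < γ₀ / 2 := by linarith
  have hI : ∫ x : ℝ, (⨆ t : ℝ,
          ‖∫ ξ in {ξ : ℝ | N ≤ |ξ| ∧ |ξ| ≤ 4*N},
              Complex.exp (Complex.I * ((x*ξ - t*(-b*ξ^3 + γ/ξ) : ℝ) : ℂ))‖) ^ (γ₀/2)
      ≤ D ^ (γ₀ / 2) * (N ^ (γ₀ / 2 - 1) * J) := by
    rw [hJ, ← integral_div_sqrt_rpow hN0, ← integral_const_mul]
    refine integral_mono_of_nonneg (.of_forall fun x => ?_)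
      ((integrable_div_sqrt_rpow hN0 (by linarith)).const_mul _) (.of_forall fun x => ?_)
    · exact Real.rpow_nonneg (Real.iSup_nonneg fun t => norm_nonneg _) _
    · dsimp only
      rw [← Real.mul_rpow hD0.le (by positivity)]
      exact Real.rpow_le_rpow (Real.iSup_nonneg fun t => norm_nonneg _)
        (ciSup_le fun t => hker x t) hp.le
  have hγpos : γ₀ ≠ 0 := by linarith
  calc _ ≤ (D ^ (γ₀ / 2) * (N ^ (γ₀ / 2 - 1) * J)) ^ (2 / γ₀) := by
        refine Real.rpow_le_rpow (integral_nonneg fun x => ?_) hI (by positivity)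
        exact Real.rpow_nonneg (Real.iSup_nonneg fun t => norm_nonneg _) _
    _ = D * J ^ (2 / γ₀) * N ^ ((γ₀ - 2) / γ₀) := by
        have h1 : γ₀ / 2 * (2 / γ₀) = 1 := by field_simp
        have h2 : (γ₀ / 2 - 1) * (2 / γ₀) = (γ₀ - 2) / γ₀ := by field_simp
        rw [Real.mul_rpow (by positivity) (by positivity), Real.mul_rpow (by positivity) hJ0,
          ← Real.rpow_mul hD0.le, ← Real.rpow_mul hN0.le, h1, h2, Real.rpow_one]
        ring
    _ ≤ _ := by gcongr; linarith
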